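/- arXiv:1804.07562 — 3 statements merged into one kernel-verified Lean document; each statement's English description precedes it below -/
import Mathlib

section
/- Let d ≥ 2. The set of values ‖X‖_∞, as X ranges over all d×d complex Hermitian matrices with tr X = 0 and ‖X‖₂ ≤ 1, has greatest element √((d−1)/d); that is, every such X satisfies ‖X‖_∞ ≤ √((d−1)/d), and there exists such an X (e.g. the diagonal matrix diag(x, −x/(d−1), …, −x/(d−1)) with x = √((d−1)/d)) attaining this value. -/
open Matrix
open scoped ComplexOrder

/-- The Frobenius (Hilbert–Schmidt) norm `√(tr(AᴴA))` of a square complex matrix. -/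
noncomputable def frobNorm {α : Type*} [Fintype α] (A : Matrix α α ℂ) : ℝ :=
  Real.sqrt ((Aᴴ * A).trace.re)

/-- The operator (spectral) norm of a square complex matrix, i.e. its largest
singular value, `√(λ_max(AᴴA))`. -/
noncomputable def opNorm {α : Type*} [Fintype α] [DecidableEq α] (A : Matrix α α ℂ) : ℝ :=
  ⨆ i, Real.sqrt ((Matrix.posSemidef_conjTranspose_mul_self A).1.eigenvalues i)

lemma sq_le_of_sum_eq_zero_of_sum_sq_le_one {α : Type*} [Fintype α] (f : α → ℝ)
    (h0 : ∑ i, f i = 0) (h1 : ∑ i, f i ^ 2 ≤ 1) (j : α) :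
    f j ^ 2 ≤ ((Fintype.card α : ℝ) - 1) / Fintype.card α := by
  classical
  have hpos : 0 < Fintype.card α := Fintype.card_pos_iff.mpr ⟨j⟩
  have hcs := sq_sum_le_card_mul_sum_sq (s := Finset.univ.erase j) (f := f)
  rw [Finset.card_erase_of_mem (Finset.mem_univ j), Finset.card_univ,
    Nat.cast_pred hpos] at hcs
  have hsum := Finset.add_sum_erase Finset.univ f (Finset.mem_univ j)
  have hsq := Finset.add_sum_erase Finset.univ (fun i => f i ^ 2) (Finset.mem_univ j)
  have hc : (1 : ℝ) ≤ Fintype.card α := by exact_mod_cast hpos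
  rw [h0] at hsum
  rw [eq_neg_of_add_eq_zero_right hsum, neg_sq] at hcs
  rw [le_div_iff₀ (by linarith)]
  have hle : ∑ i ∈ Finset.univ.erase j, f i ^ 2 ≤ 1 - f j ^ 2 := by linarith
  linarith [mul_le_mul_of_nonneg_left hle (sub_nonneg.mpr hc)]

namespace Matrix.IsHermitian

variable {α : Type*} [Fintype α] [DecidableEq α] {A : Matrix α α ℂ}

lemma conjTranspose_mul_self_eq (hA : A.IsHermitian) :
    Aᴴ * A = Unitary.conjStarAlgAut ℂ _ hA.eigenvectorUnitary
      (diagonal fun i => ((hA.eigenvalues i : ℂ)) ^ 2) := by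
  rw [hA.eq]
  conv_lhs => rw [hA.spectral_theorem]
  rw [← map_mul, diagonal_mul_diagonal]
  simp [pow_two]

lemma trace_conjTranspose_mul_self (hA : A.IsHermitian) :
    (Aᴴ * A).trace = ∑ i, (hA.eigenvalues i : ℂ) ^ 2 := by
  rw [hA.conjTranspose_mul_self_eq, Unitary.conjStarAlgAut_apply, trace_mul_comm, ← mul_assoc]
  simp [trace_diagonal]

lemma exists_eigenvalues_conjTranspose_mul_self_eq (hA : A.IsHermitian) (i : α) :
    ∃ j, (posSemidef_conjTranspose_mul_self A).1.eigenvalues i = hA.eigenvalues j ^ 2 := by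
  have hi := (posSemidef_conjTranspose_mul_self A).1.eigenvalues_mem_spectrum_real i
  rw [← spectrum.algebraMap_mem_iff ℂ] at hi
  conv at hi => arg 1; rw [hA.conjTranspose_mul_self_eq]
  rw [AlgEquiv.spectrum_eq, spectrum_diagonal] at hi
  obtain ⟨j, hj⟩ := hi
  exact ⟨j, Complex.ofReal_injective (by simpa using hj.symm)⟩

lemma opNorm_le_of_trace_eq_zero (hA : A.IsHermitian) (h0 : A.trace = 0)
    (h1 : frobNorm A ≤ 1) :
    opNorm A ≤ √(((Fintype.card α : ℝ) - 1) / Fintype.card α) := by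
  refine Real.iSup_le (fun i => Real.sqrt_le_sqrt ?_) (Real.sqrt_nonneg _)
  obtain ⟨j, hj⟩ := hA.exists_eigenvalues_conjTranspose_mul_self_eq i
  rw [hj]
  refine sq_le_of_sum_eq_zero_of_sum_sq_le_one _ ?_ ?_ j
  · rw [hA.trace_eq_sum_eigenvalues] at h0
    exact Complex.ofReal_injective (by simpa using h0)
  · rw [frobNorm, hA.trace_conjTranspose_mul_self, Real.sqrt_le_one] at h1
    exact_mod_cast h1

end Matrix.IsHermitian

lemma norm_le_opNorm_diagonal {α : Type*} [Fintype α] [DecidableEq α] (v : α → ℂ) (j : α) :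
    ‖v j‖ ≤ opNorm (diagonal v) := by
  have hH := (posSemidef_conjTranspose_mul_self (diagonal v)).1
  have hmem : ((‖v j‖ ^ 2 : ℝ) : ℂ) ∈ spectrum ℂ ((diagonal v)ᴴ * diagonal v) := by
    rw [diagonal_conjTranspose, diagonal_mul_diagonal, spectrum_diagonal]
    exact ⟨j, by simp [Complex.conj_mul']⟩
  rw [hH.spectrum_eq_image_range] at hmem
  obtain ⟨_, ⟨i, rfl⟩, hi⟩ := hmem
  have hi' : hH.eigenvalues i = ‖v j‖ ^ 2 := Complex.ofReal_injective hi
  calc ‖v j‖ = √(hH.eigenvalues i) := by rw [hi', Real.sqrt_sq (norm_nonneg _)]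
    _ ≤ _ := le_ciSup (f := fun i => √(hH.eigenvalues i)) (Set.finite_range _).bddAbove i

/-- A real vector with coordinates `(x, -x/(d-1), …, -x/(d-1))` up to the choice of the
distinguished index, where `x = √((d-1)/d)` and `d` is the number of indices. -/
noncomputable def extremalVector {α : Type*} [Fintype α] [DecidableEq α] (j : α) : α → ℝ :=
  Function.update
    (fun _ => -√(((Fintype.card α : ℝ) - 1) / Fintype.card α) / ((Fintype.card α : ℝ) - 1))
    j √(((Fintype.card α : ℝ) - 1) / Fintype.card α)

section extremalVector

variable {α : Type*} [Fintype α] [DecidableEq α]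

lemma sum_extremalVector (hα : 2 ≤ Fintype.card α) (j : α) : ∑ i, extremalVector j i = 0 := by
  have hc : (2 : ℝ) ≤ Fintype.card α := by exact_mod_cast hα
  have hne : (Fintype.card α : ℝ) - 1 ≠ 0 := by linarith
  rw [extremalVector, Finset.sum_update_of_mem (Finset.mem_univ j), Finset.sum_const,
    Finset.card_sdiff_of_subset (by simp), Finset.card_singleton, Finset.card_univ, nsmul_eq_mul,
    Nat.cast_pred (by lia)]
  field_simp
  ring

lemma sum_extremalVector_sq (hα : 2 ≤ Fintype.card α) (j : α) :
    ∑ i, extremalVector j i ^ 2 = 1 := by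
  have hc : (2 : ℝ) ≤ Fintype.card α := by exact_mod_cast hα
  have hne : (Fintype.card α : ℝ) - 1 ≠ 0 := by linarith
  have hne' : (Fintype.card α : ℝ) ≠ 0 := by linarith
  rw [← Finset.add_sum_erase _ _ (Finset.mem_univ j),
    Finset.sum_congr rfl fun i hi => by
      rw [extremalVector, Function.update_of_ne (Finset.ne_of_mem_erase hi)],
    extremalVector, Function.update_self, Finset.sum_const,
    Finset.card_erase_of_mem (Finset.mem_univ j), Finset.card_univ, nsmul_eq_mul,
    Nat.cast_pred (by lia), div_pow, neg_sq,
    Real.sq_sqrt (div_nonneg (by linarith) (by linarith))]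
  field_simp
  ring

end extremalVector

/-- For `d ≥ 2`, the set of values `‖X‖_∞`, as `X` ranges over all `d×d`
complex Hermitian matrices with `tr X = 0` and `‖X‖₂ ≤ 1`, has greatest element
`√((d−1)/d)`. -/
theorem stmt0 (d : ℕ) (hd : 2 ≤ d) :
    IsGreatest {x : ℝ | ∃ X : Matrix (Fin d) (Fin d) ℂ,
        X.IsHermitian ∧ X.trace = 0 ∧ frobNorm X ≤ 1 ∧ opNorm X = x}
      (Real.sqrt (((d : ℝ) - 1) / d)) := by
  have upper (X : Matrix (Fin d) (Fin d) ℂ) (hX : X.IsHermitian) (h0 : X.trace = 0)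
      (h1 : frobNorm X ≤ 1) : opNorm X ≤ √(((d : ℝ) - 1) / d) := by
    simpa using hX.opNorm_le_of_trace_eq_zero h0 h1
  refine ⟨?_, ?_⟩
  · let j : Fin d := ⟨0, by lia⟩
    have hcard : 2 ≤ Fintype.card (Fin d) := by simpa using hd
    let X : Matrix (Fin d) (Fin d) ℂ := diagonal fun i => (extremalVector j i : ℂ)
    have hX : X.IsHermitian := isHermitian_diagonal_of_self_adjoint _ (by ext; simp)
    have h0 : X.trace = 0 := by
      rw [trace_diagonal]
      exact_mod_cast sum_extremalVector hcard j
    have h1 : frobNorm X ≤ 1 := by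
      rw [frobNorm, hX.eq, diagonal_mul_diagonal, trace_diagonal, Real.sqrt_le_one]
      have := (sum_extremalVector_sq hcard j).le
      simp only [pow_two] at this
      exact_mod_cast this
    refine ⟨X, hX, h0, h1, (upper X hX h0 h1).antisymm ?_⟩
    have := norm_le_opNorm_diagonal (fun i => (extremalVector j i : ℂ)) j
    refine le_trans (le_of_eq ?_) this
    simp [extremalVector, abs_of_nonneg]
  · rintro _ ⟨X, hX, h0, h1, rfl⟩
    exact upper X hX h0 h1
end

section
/- Let n ≥ 1 and set d = n². Let ρ be a Hermitian matrix indexed by Fin n × Fin n, let r ≥ 0, and let X be a Hermitian matrix indexed by Fin n × Fin n with tr X = 0 and ‖X‖₂ ≤ 1. Then λ_min(Γ(ρ + rX)) ≥ λ_min(Γ(ρ)) − r√((d−1)/d). -/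
open Matrix
open scoped ComplexOrder

open Classical in
/-- The smallest eigenvalue of a Hermitian matrix (junk value `0` otherwise). -/
noncomputable def eigMin {α : Type*} [Fintype α] [DecidableEq α] (A : Matrix α α ℂ) : ℝ :=
  if hA : A.IsHermitian then ⨅ i, hA.eigenvalues i else 0

/-- The partial transpose map: `Γ(X)_{(i,k),(j,l)} = X_{(i,l),(j,k)}`. -/
def ptrans {α : Type*} (X : Matrix (α × α) (α × α) ℂ) : Matrix (α × α) (α × α) ℂ :=
  Matrix.of fun p q => X (p.1, q.2) (q.1, p.2)

namespace Matrix.IsHermitian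

variable {α : Type*} [Fintype α] [DecidableEq α] {A : Matrix α α ℂ}

theorem posSemidef_sub_smul_one (hA : A.IsHermitian) {c : ℝ}
    (hc : ∀ i, c ≤ hA.eigenvalues i) : (A - (c : ℂ) • (1 : Matrix α α ℂ)).PosSemidef := by
  have hdiag : (diagonal (fun i => ((hA.eigenvalues i - c : ℝ) : ℂ))).PosSemidef :=
    posSemidef_diagonal_iff.mpr fun i => by
      exact_mod_cast sub_nonneg.mpr (hc i)
  have h := hdiag.mul_mul_conjTranspose_same (hA.eigenvectorUnitary : Matrix α α ℂ)
  convert h using 1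
  have hsplit : diagonal (fun i => ((hA.eigenvalues i - c : ℝ) : ℂ)) =
      diagonal (RCLike.ofReal ∘ hA.eigenvalues) - (c : ℂ) • (1 : Matrix α α ℂ) := by
    ext i j
    by_cases hij : i = j <;> simp [hij]
  have hU : (hA.eigenvectorUnitary : Matrix α α ℂ) *
      (hA.eigenvectorUnitary : Matrix α α ℂ)ᴴ = 1 :=
    Unitary.coe_mul_star_self hA.eigenvectorUnitary
  rw [hsplit, Matrix.mul_sub, Matrix.sub_mul, Matrix.mul_smul, Matrix.smul_mul, Matrix.mul_one, hU]
  congr 1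
  exact hA.spectral_theorem

theorem le_eigenvalues_of_posSemidef_sub_smul_one (hA : A.IsHermitian) {c : ℝ}
    (h : (A - (c : ℂ) • (1 : Matrix α α ℂ)).PosSemidef) (i : α) : c ≤ hA.eigenvalues i := by
  have h1 := h.re_dotProduct_nonneg ⇑(hA.eigenvectorBasis i)
  have hnorm : star ⇑(hA.eigenvectorBasis i) ⬝ᵥ ⇑(hA.eigenvectorBasis i) = (1 : ℂ) := by
    rw [dotProduct_comm, ← EuclideanSpace.inner_eq_star_dotProduct,
      inner_self_eq_norm_sq_to_K, hA.eigenvectorBasis.orthonormal.1 i]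
    simp
  rw [sub_mulVec, dotProduct_sub, map_sub, ← hA.eigenvalues_eq i, smul_mulVec, one_mulVec,
    dotProduct_smul, hnorm] at h1
  simpa using h1

theorem trace_mul_self_eq_sum_eigenvalues_sq (hA : A.IsHermitian) :
    (A * A).trace = ((∑ i, hA.eigenvalues i ^ 2 : ℝ) : ℂ) := by
  conv_lhs => rw [hA.spectral_theorem, ← map_mul, Unitary.conjStarAlgAut_apply, trace_mul_cycle]
  simp [trace, diagonal_mul_diagonal, pow_two]

end Matrix.IsHermitian

theorem card_mul_sq_le_of_sum_eq_zero {ι : Type*} [Fintype ι] {f : ι → ℝ}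
    (h0 : ∑ i, f i = 0) (h2 : ∑ i, f i ^ 2 ≤ 1) (i : ι) :
    Fintype.card ι * f i ^ 2 ≤ Fintype.card ι - 1 := by
  classical
  have hs := sq_sum_le_card_mul_sum_sq (s := Finset.univ.erase i) (f := f)
  have e1 := Finset.add_sum_erase Finset.univ f (Finset.mem_univ i)
  have e2 := Finset.add_sum_erase Finset.univ (fun j => f j ^ 2) (Finset.mem_univ i)
  have hpos : 1 ≤ Fintype.card ι := Fintype.card_pos_iff.mpr ⟨i⟩
  rw [Finset.card_erase_of_mem (Finset.mem_univ i), Finset.card_univ, Nat.cast_sub hpos,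
    Nat.cast_one] at hs
  have e3 : ∑ j ∈ Finset.univ.erase i, f j = - f i := by linarith
  have e4 : ∑ j ∈ Finset.univ.erase i, f j ^ 2 ≤ 1 - f i ^ 2 := by linarith
  have hc : (0 : ℝ) ≤ Fintype.card ι - 1 := by
    rw [sub_nonneg]
    exact_mod_cast hpos
  rw [e3] at hs
  have := mul_le_mul_of_nonneg_left e4 hc
  linarith

section PartialTranspose

variable {α : Type*}

theorem ptrans_isHermitian {X : Matrix (α × α) (α × α) ℂ} (hX : X.IsHermitian) :
    (ptrans X).IsHermitian := by
  ext p q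
  exact hX.apply _ _

theorem ptrans_add_smul (X Y : Matrix (α × α) (α × α) ℂ) (c : ℂ) :
    ptrans (X + c • Y) = ptrans X + c • ptrans Y := rfl

variable [Fintype α]

theorem trace_ptrans (X : Matrix (α × α) (α × α) ℂ) : (ptrans X).trace = X.trace := rfl

theorem trace_ptrans_mul_ptrans (X Y : Matrix (α × α) (α × α) ℂ) :
    (ptrans X * ptrans Y).trace = (X * Y).trace := by
  simp only [trace, diag_apply, mul_apply, ptrans, of_apply, Fintype.sum_prod_type]
  refine Finset.sum_congr rfl fun a _ => ?_
  rw [Finset.sum_comm]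
  conv_rhs => rw [Finset.sum_comm]
  refine Finset.sum_congr rfl fun b _ => ?_
  exact Finset.sum_comm

end PartialTranspose

theorem eigMin_le_eigenvalues {α : Type*} [Fintype α] [DecidableEq α] {A : Matrix α α ℂ}
    (hA : A.IsHermitian) (i : α) : eigMin A ≤ hA.eigenvalues i := by
  rw [eigMin, dif_pos hA]
  exact ciInf_le (Set.finite_range _).bddBelow i

/-- For `n ≥ 1`, `d = n²`, a Hermitian `ρ` indexed by `Fin n × Fin n`,
`r ≥ 0`, and a Hermitian `X` with `tr X = 0` and `‖X‖₂ ≤ 1`, we have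
`λ_min(Γ(ρ + rX)) ≥ λ_min(Γ(ρ)) − r√((d−1)/d)`. -/
theorem stmt4 (n : ℕ) (hn : 1 ≤ n) (ρ X : Matrix (Fin n × Fin n) (Fin n × Fin n) ℂ)
    (hρ : ρ.IsHermitian) (r : ℝ) (hr : 0 ≤ r)
    (hX : X.IsHermitian) (hXtr : X.trace = 0) (hX2 : frobNorm X ≤ 1) :
    eigMin (ptrans (ρ + (r : ℂ) • X)) ≥
      eigMin (ptrans ρ) - r * Real.sqrt (((n : ℝ) ^ 2 - 1) / (n : ℝ) ^ 2) := by
  have : Nonempty (Fin n × Fin n) := ⟨⟨⟨0, hn⟩, ⟨0, hn⟩⟩⟩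
  have hH := ptrans_isHermitian hρ
  have hY := ptrans_isHermitian hX
  have hrX : (ρ + (r : ℂ) • X).IsHermitian :=
    hρ.add (hX.smul (Complex.conj_ofReal r))
  have hS := ptrans_isHermitian hrX
  set c := Real.sqrt (((n : ℝ) ^ 2 - 1) / (n : ℝ) ^ 2)
  have hsum : ∑ i, hY.eigenvalues i = 0 := by
    have h := hY.trace_eq_sum_eigenvalues
    rw [trace_ptrans, hXtr] at h
    rw [← RCLike.ofReal_sum] at h
    exact RCLike.ofReal_eq_zero.mp h.symm
  have hsq : ∑ i, hY.eigenvalues i ^ 2 ≤ 1 := by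
    rw [frobNorm, Real.sqrt_le_iff, one_pow, hX.eq, ← trace_ptrans_mul_ptrans,
      hY.trace_mul_self_eq_sum_eigenvalues_sq, Complex.ofReal_re] at hX2
    exact hX2.2
  have hc : ∀ i, -c ≤ hY.eigenvalues i := fun i => by
    have hn0 : (0 : ℝ) < (n : ℝ) ^ 2 := by positivity
    have h := card_mul_sq_le_of_sum_eq_zero hsum hsq i
    simp only [Fintype.card_prod, Fintype.card_fin, ← pow_two, Nat.cast_pow] at h
    refine neg_le_of_abs_le (Real.abs_le_sqrt ?_)
    rw [le_div_iff₀ hn0]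
    linarith
  have hpsd := (hH.posSemidef_sub_smul_one (eigMin_le_eigenvalues hH)).add
    ((hY.posSemidef_sub_smul_one hc).smul (show (0 : ℂ) ≤ r by exact_mod_cast hr))
  conv_lhs => rw [eigMin, dif_pos hS]
  refine le_ciInf (hS.le_eigenvalues_of_posSemidef_sub_smul_one ?_)
  convert hpsd using 1
  rw [ptrans_add_smul]
  push_cast
  module
end

section
/- Fix a real number m > 0 and a real s ≥ 0. The function u ↦ q_m(s, u) := e^{−u/2} Σ_{l=0}^{∞} ((u/2)^l / l!) · γ̃(l + m/2, s/2) is antitone (monotonically decreasing) in u on [0, ∞). -/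
/-- The regularized lower incomplete gamma function
`γ̃(a, z) = (1/Γ(a)) ∫₀^z t^(a−1) e^(−t) dt`. -/
noncomputable def regGamma (a z : ℝ) : ℝ :=
  (∫ t in (0 : ℝ)..z, t ^ (a - 1) * Real.exp (-t)) / Real.Gamma a

/-- The cumulative distribution function of the noncentral χ²-distribution with `m`
degrees of freedom and noncentrality parameter `u`, evaluated at `s`:
`q_m(s, u) = e^(−u/2) Σ_{l} ((u/2)^l / l!) γ̃(l + m/2, s/2)`. -/
noncomputable def qchi (m s u : ℝ) : ℝ :=
  Real.exp (-u / 2) * ∑' l : ℕ, ((u / 2) ^ l / l.factorial) * regGamma (l + m / 2) (s / 2)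

open intervalIntegral in
theorem intervalIntegrable_rpow_mul_exp_neg {a : ℝ} (ha : 0 < a) (z : ℝ) :
    IntervalIntegrable (fun t : ℝ => t ^ (a - 1) * Real.exp (-t)) MeasureTheory.volume 0 z :=
  (intervalIntegrable_rpow' (by linarith)).mul_continuousOn (by fun_prop)

theorem integral_rpow_mul_exp_neg_add_one {a z : ℝ} (ha : 0 < a) (hz : 0 ≤ z) :
    ∫ t in (0 : ℝ)..z, t ^ (a + 1 - 1) * Real.exp (-t) =
      a * (∫ t in (0 : ℝ)..z, t ^ (a - 1) * Real.exp (-t)) - z ^ a * Real.exp (-z) := by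
  have h₀ := (intervalIntegrable_rpow_mul_exp_neg ha z).const_mul a
  have h₁ := intervalIntegrable_rpow_mul_exp_neg (add_pos ha one_pos) z
  have key := intervalIntegral.integral_eq_sub_of_hasDerivAt_of_le hz
    (f := fun t : ℝ => t ^ a * Real.exp (-t))
    (f' := fun t => a * (t ^ (a - 1) * Real.exp (-t)) - t ^ (a + 1 - 1) * Real.exp (-t))
    ((Real.continuous_rpow_const ha.le).mul (by fun_prop)).continuousOn
    (fun t ht => by
      have h := (Real.hasDerivAt_rpow_const (p := a) (Or.inl ht.1.ne')).mul
        (hasDerivAt_id t).neg.exp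
      refine h.congr_deriv ?_
      simp only [add_sub_cancel_right, Pi.neg_apply, id]
      ring)
    (h₀.sub h₁)
  rw [intervalIntegral.integral_sub h₀ h₁, intervalIntegral.integral_const_mul,
    Real.zero_rpow ha.ne', zero_mul, sub_zero] at key
  linarith

theorem regGamma_nonneg {a z : ℝ} (ha : 0 < a) (hz : 0 ≤ z) : 0 ≤ regGamma a z :=
  div_nonneg (intervalIntegral.integral_nonneg hz fun _ ht =>
    mul_nonneg (Real.rpow_nonneg ht.1 _) (Real.exp_pos _).le) (Real.Gamma_pos_of_pos ha).le

theorem regGamma_add_one_le {a z : ℝ} (ha : 0 < a) (hz : 0 ≤ z) :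
    regGamma (a + 1) z ≤ regGamma a z := by
  have hΓ := Real.Gamma_pos_of_pos ha
  have hnn : 0 ≤ z ^ a * Real.exp (-z) := by positivity
  rw [regGamma, regGamma, integral_rpow_mul_exp_neg_add_one ha hz, Real.Gamma_add_one ha.ne',
    ← mul_div_mul_left _ (Real.Gamma a) ha.ne']
  gcongr
  linarith

theorem antitone_regGamma_natCast_add {a z : ℝ} (ha : 0 < a) (hz : 0 ≤ z) :
    Antitone fun l : ℕ => regGamma (l + a) z :=
  antitone_nat_of_succ_le fun l => by
    have h := regGamma_add_one_le (a := l + a) (by positivity) hz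
    rwa [add_right_comm, ← Nat.cast_add_one] at h

theorem summable_pow_div_factorial_mul_of_antitone {c : ℕ → ℝ} (hc : Antitone c)
    (hc₀ : ∀ l, 0 ≤ c l) {x : ℝ} (hx : 0 ≤ x) :
    Summable fun l : ℕ => x ^ l / l.factorial * c l :=
  .of_nonneg_of_le (fun l => mul_nonneg (by positivity) (hc₀ l))
    (fun l => mul_le_mul_of_nonneg_left (hc l.zero_le) (by positivity))
    ((Real.summable_pow_div_factorial x).mul_right (c 0))

theorem add_pow_div_factorial (x h : ℝ) (n : ℕ) :
    (x + h) ^ n / n.factorial =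
      ∑ p ∈ Finset.HasAntidiagonal.antidiagonal n, x ^ p.1 / p.1.factorial * (h ^ p.2 / p.2.factorial) := by
  rw [(Commute.all x h).add_pow', Finset.sum_div]
  refine Finset.sum_congr rfl fun p hp => ?_
  obtain rfl := Finset.HasAntidiagonal.mem_antidiagonal.mp hp
  rw [nsmul_eq_mul, Nat.cast_add_choose]
  field_simp

/-- The expectation of an antitone nonnegative sequence under the Poisson distribution is antitone
in the rate. -/
theorem antitoneOn_exp_neg_mul_tsum {c : ℕ → ℝ} (hc : Antitone c) (hc₀ : ∀ l, 0 ≤ c l) :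
    AntitoneOn (fun x : ℝ => Real.exp (-x) * ∑' l : ℕ, x ^ l / l.factorial * c l)
      (Set.Ici 0) := by
  intro x hx y hy hxy
  obtain ⟨h, rfl⟩ := exists_add_of_le hxy
  have hx : 0 ≤ x := hx
  have hh : 0 ≤ h := by linarith
  have hsx := summable_pow_div_factorial_mul_of_antitone hc hc₀ hx
  have hsh := Real.summable_pow_div_factorial h
  have hle : ∑' l : ℕ, (x + h) ^ l / l.factorial * c l ≤
      (∑' l : ℕ, x ^ l / l.factorial * c l) * Real.exp h := by
    rw [Real.exp_eq_exp_ℝ, NormedSpace.exp_eq_tsum_div,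
      tsum_mul_tsum_eq_tsum_sum_antidiagonal_of_summable_norm hsx.norm hsh.norm]
    refine (summable_pow_div_factorial_mul_of_antitone hc hc₀ hy).tsum_le_tsum (fun n => ?_)
      (summable_norm_sum_mul_antidiagonal_of_summable_norm hsx.norm hsh.norm).of_norm
    rw [add_pow_div_factorial, Finset.sum_mul]
    refine Finset.sum_le_sum fun p hp => ?_
    rw [mul_right_comm]
    have hpn := hc ((Nat.le_add_right _ _).trans_eq (Finset.HasAntidiagonal.mem_antidiagonal.mp hp))
    gcongr
  calc Real.exp (-(x + h)) * ∑' l : ℕ, (x + h) ^ l / l.factorial * c l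
      ≤ Real.exp (-(x + h)) * ((∑' l : ℕ, x ^ l / l.factorial * c l) * Real.exp h) := by gcongr
    _ = Real.exp (-x) * ∑' l : ℕ, x ^ l / l.factorial * c l := by
      rw [neg_add, Real.exp_add, Real.exp_neg h]
      field_simp

/-- for fixed real `m > 0` and `s ≥ 0`, the function `u ↦ q_m(s, u)` is
antitone (monotonically decreasing) on `[0, ∞)`. -/
theorem stmt14 (m s : ℝ) (hm : 0 < m) (hs : 0 ≤ s) :
    AntitoneOn (fun u => qchi m s u) (Set.Ici (0 : ℝ)) := by
  intro u hu v hv huv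
  have hu : 0 ≤ u := hu
  have hv : 0 ≤ v := hv
  have h := antitoneOn_exp_neg_mul_tsum
    (antitone_regGamma_natCast_add (half_pos hm) (div_nonneg hs zero_le_two))
    (fun l => regGamma_nonneg (by positivity) (div_nonneg hs zero_le_two))
    (div_nonneg hu zero_le_two) (div_nonneg hv zero_le_two) (div_le_div_of_nonneg_right huv zero_le_two)
  simpa only [qchi, neg_div] using h
end
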